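/- Let Φ be a closed QBF. Then Φ is satisfiable (i.e., Φ evaluates to true under the standard Boolean semantics) if and only if the first-order sentence T(Φ) ∧ p(f₁) ∧ ¬p(f₀) is satisfiable, i.e., has a first-order model in the language consisting of the unary predicate symbol p and the constant symbols f₀ and f₁. -/

import Mathlib

/-- Quantified Boolean formulas. -/
inductive QBF where
  | bot | top
  | var (x : ℕ)
  | not (φ : QBF)
  | and (φ ψ : QBF) | or (φ ψ : QBF) | imp (φ ψ : QBF) | iff (φ ψ : QBF) | xor (φ ψ : QBF)
  | all (x : ℕ) (φ : QBF)
  | ex (x : ℕ) (φ : QBF)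

/-- The free variables of a QBF. -/
def QBF.free : QBF → Finset ℕ
  | .bot => ∅
  | .top => ∅
  | .var x => {x}
  | .not φ => φ.free
  | .and φ ψ | .or φ ψ | .imp φ ψ | .iff φ ψ | .xor φ ψ => φ.free ∪ ψ.free
  | .all x φ => φ.free.erase x
  | .ex x φ => φ.free.erase x

/-- Standard Boolean semantics of QBFs. -/
def QBF.eval (v : ℕ → Bool) : QBF → Bool
  | .bot => false
  | .top => true
  | .var x => v x
  | .not φ => !(φ.eval v)
  | .and φ ψ => φ.eval v && ψ.eval v
  | .or φ ψ => φ.eval v || ψ.eval v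
  | .imp φ ψ => !(φ.eval v) || ψ.eval v
  | .iff φ ψ => φ.eval v == ψ.eval v
  | .xor φ ψ => φ.eval v != ψ.eval v
  | .all x φ => φ.eval (Function.update v x true) && φ.eval (Function.update v x false)
  | .ex x φ => φ.eval (Function.update v x true) || φ.eval (Function.update v x false)

/-- First-order terms of the language with constants f₀, f₁. -/
inductive FOT where
  | var (x : ℕ) | f0 | f1

/-- First-order formulas over the language with unary predicate `p`
and constants f₀, f₁ (`atom t` denotes `p(t)`). -/
inductive FOF where
  | atom (t : FOT)
  | not (φ : FOF)
  | and (φ ψ : FOF) | or (φ ψ : FOF) | imp (φ ψ : FOF) | iff (φ ψ : FOF) | xor (φ ψ : FOF)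
  | all (x : ℕ) (φ : FOF)
  | ex (x : ℕ) (φ : FOF)

/-- The translation T of QBFs into first-order formulas. -/
def trQ : QBF → FOF
  | .bot => .atom .f0
  | .top => .atom .f1
  | .var x => .atom (.var x)
  | .not φ => .not (trQ φ)
  | .and φ ψ => .and (trQ φ) (trQ ψ)
  | .or φ ψ => .or (trQ φ) (trQ ψ)
  | .imp φ ψ => .imp (trQ φ) (trQ ψ)
  | .iff φ ψ => .iff (trQ φ) (trQ ψ)
  | .xor φ ψ => .xor (trQ φ) (trQ ψ)
  | .all x φ => .all x (trQ φ)
  | .ex x φ => .ex x (trQ φ)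

/-- A first-order structure for the language {p, f₀, f₁}. -/
structure FStruct where
  D : Type
  pI : D → Prop
  c0 : D
  c1 : D

def FOT.interp (S : FStruct) (v : ℕ → S.D) : FOT → S.D
  | .var x => v x
  | .f0 => S.c0
  | .f1 => S.c1

/-- Tarskian satisfaction. -/
def FOF.interp (S : FStruct) (v : ℕ → S.D) : FOF → Prop
  | .atom t => S.pI (t.interp S v)
  | .not φ => ¬ φ.interp S v
  | .and φ ψ => φ.interp S v ∧ ψ.interp S v
  | .or φ ψ => φ.interp S v ∨ ψ.interp S v
  | .imp φ ψ => φ.interp S v → ψ.interp S v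
  | .iff φ ψ => φ.interp S v ↔ ψ.interp S v
  | .xor φ ψ => ¬ (φ.interp S v ↔ ψ.interp S v)
  | .all x φ => ∀ d : S.D, φ.interp S (Function.update v x d)
  | .ex x φ => ∃ d : S.D, φ.interp S (Function.update v x d)

theorem trQ_key (S : FStruct) (h1 : S.pI S.c1) (h0 : ¬ S.pI S.c0) (φ : QBF) :
    ∀ (w : ℕ → Bool) (v : ℕ → S.D), (∀ x ∈ φ.free, (w x = true ↔ S.pI (v x))) →
      (φ.eval w = true ↔ (trQ φ).interp S v) := by
  have upd : ∀ (ψ : QBF) (x : ℕ) (w : ℕ → Bool) (v : ℕ → S.D) (b : Bool) (d : S.D),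
      (∀ y ∈ ψ.free.erase x, (w y = true ↔ S.pI (v y))) → (b = true ↔ S.pI d) →
      ∀ y ∈ ψ.free, (Function.update w x b y = true ↔ S.pI (Function.update v x d y)) := by
    intro ψ x w v b d h hb y hy
    by_cases hyx : y = x
    · subst hyx
      simpa using hb
    · simpa [hyx] using h y (Finset.mem_erase.2 ⟨hyx, hy⟩)
  induction φ with
  | bot => intro w v _; simpa [QBF.eval, trQ, FOF.interp, FOT.interp] using h0
  | top => intro w v _; simpa [QBF.eval, trQ, FOF.interp, FOT.interp] using h1
  | var x => intro w v h; exact h x (by simp [QBF.free])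
  | not φ ih =>
    intro w v h
    have := ih w v h
    simp only [QBF.eval, trQ, FOF.interp, ← this]
    simp
  | and φ ψ ih1 ih2 | or φ ψ ih1 ih2 | imp φ ψ ih1 ih2 | iff φ ψ ih1 ih2 | xor φ ψ ih1 ih2 =>
    intro w v h
    have a := ih1 w v (fun x hx => h x (Finset.mem_union_left _ hx))
    have b := ih2 w v (fun x hx => h x (Finset.mem_union_right _ hx))
    simp only [QBF.eval, trQ, FOF.interp, ← a, ← b]
    cases φ.eval w <;> cases ψ.eval w <;> simp
  | all x φ ih =>
    intro w v h
    simp only [QBF.eval, trQ, FOF.interp, Bool.and_eq_true]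
    constructor
    · rintro ⟨ht, hf⟩ d
      by_cases hd : S.pI d
      · exact (ih _ _ (upd φ x w v true d h (by simpa using hd))).1 ht
      · exact (ih _ _ (upd φ x w v false d h (by simpa using hd))).1 hf
    · intro hd
      exact ⟨(ih _ _ (upd φ x w v true S.c1 h (by simpa using h1))).2 (hd _),
        (ih _ _ (upd φ x w v false S.c0 h (by simpa using h0))).2 (hd _)⟩
  | ex x φ ih =>
    intro w v h
    simp only [QBF.eval, trQ, FOF.interp, Bool.or_eq_true]
    constructor
    · rintro (ht | hf)
      · exact ⟨_, (ih _ _ (upd φ x w v true S.c1 h (by simpa using h1))).1 ht⟩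
      · exact ⟨_, (ih _ _ (upd φ x w v false S.c0 h (by simpa using h0))).1 hf⟩
    · rintro ⟨d, hd⟩
      by_cases hp : S.pI d
      · exact Or.inl ((ih _ _ (upd φ x w v true d h (by simpa using hp))).2 hd)
      · exact Or.inr ((ih _ _ (upd φ x w v false d h (by simpa using hp))).2 hd)

/-- a closed QBF Φ is satisfiable (evaluates to true) iff the
first-order sentence T(Φ) ∧ p(f₁) ∧ ¬p(f₀) has a first-order model. -/
theorem qbf_sat_iff_fo_sat (Φ : QBF) (hclosed : Φ.free = ∅) :
    Φ.eval (fun _ => false) = true ↔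
      ∃ (S : FStruct) (v : ℕ → S.D),
        (trQ Φ).interp S v ∧ S.pI S.c1 ∧ ¬ S.pI S.c0 := by
  constructor
  · intro h
    let S : FStruct := ⟨Bool, fun b => b = true, false, true⟩
    have h1 : S.pI S.c1 := rfl
    have h0 : ¬ S.pI S.c0 := Bool.false_ne_true
    exact ⟨S, fun _ => S.c0, (trQ_key S h1 h0 Φ _ _ (by simp [hclosed])).1 h, h1, h0⟩
  · rintro ⟨S, v, h, h1, h0⟩
    exact (trQ_key S h1 h0 Φ _ v (by simp [hclosed])).2 h
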